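/- Typed strong normalization: if Γ ⊢ M : t, where M is loop-free and every sum type occurring in the typing derivation is indexed by a nonempty finite set of choices, then M is strongly normalizing for reduction →, i.e. there is no infinite sequence of →-steps from M. -/

import Mathlib

variable {Loc Ch : Type}

/-- FMC terms: variable, push `[N]a.M`, pop `a<x>.M` (de Bruijn binder),
choice `i`, case `M ; i -> N`, and loop `M^i`. -/
inductive Tm (Loc Ch : Type) : Type where
  | var : ℕ → Tm Loc Ch
  | push : Tm Loc Ch → Loc → Tm Loc Ch → Tm Loc Ch
  | pop : Loc → Tm Loc Ch → Tm Loc Ch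
  | choice : Ch → Tm Loc Ch
  | caseOf : Tm Loc Ch → Ch → Tm Loc Ch → Tm Loc Ch
  | loop : Tm Loc Ch → Ch → Tm Loc Ch

namespace Tm

/-- Shift the free de Bruijn indices `≥ d` up by one. -/
def lift : Tm Loc Ch → ℕ → Tm Loc Ch
  | var n, d => if n < d then var n else var (n + 1)
  | push N a M, d => push (N.lift d) a (M.lift d)
  | pop a M, d => pop a (M.lift (d + 1))
  | choice i, _ => choice i
  | caseOf M i N, d => caseOf (M.lift d) i (N.lift d)
  | loop M i, d => loop (M.lift d) i

/-- Capture-avoiding substitution `{N/k}M` for the de Bruijn index `k`. -/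
def subst : Tm Loc Ch → ℕ → Tm Loc Ch → Tm Loc Ch
  | var n, k, N => if n = k then N else if n < k then var n else var (n - 1)
  | push P a M, k, N => push (P.subst k N) a (M.subst k N)
  | pop a M, k, N => pop a (M.subst (k + 1) (N.lift 0))
  | choice i, _, _ => choice i
  | caseOf M i P, k, N => caseOf (M.subst k N) i (P.subst k N)
  | loop M i, k, N => loop (M.subst k N) i

end Tm

/-- A term is loop-free if it contains no subterm of the form `M^i`. -/
def Tm.loopFree : Tm Loc Ch → Prop
  | .var _ => True
  | .push N _ M => N.loopFree ∧ M.loopFree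
  | .pop _ M => M.loopFree
  | .choice _ => True
  | .caseOf M _ N => M.loopFree ∧ N.loopFree
  | .loop _ _ => False

/-- Reduction: the closure under arbitrary contexts of the rules
beta, passage, select, reject, prefix(pop), prefix(push), associate, unroll. -/
inductive Step : Tm Loc Ch → Tm Loc Ch → Prop where
  | beta (N : Tm Loc Ch) (a : Loc) (M : Tm Loc Ch) :
      Step (.push N a (.pop a M)) (M.subst 0 N)
  | passage (N : Tm Loc Ch) (a b : Loc) (M : Tm Loc Ch) (h : a ≠ b) :
      Step (.push N b (.pop a M)) (.pop a (.push (N.lift 0) b M))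
  | select (i : Ch) (M : Tm Loc Ch) :
      Step (.caseOf (.choice i) i M) M
  | reject (i j : Ch) (M : Tm Loc Ch) (h : i ≠ j) :
      Step (.caseOf (.choice i) j M) (.choice i)
  | prefixPop (a : Loc) (N : Tm Loc Ch) (i : Ch) (M : Tm Loc Ch) :
      Step (.caseOf (.pop a N) i M) (.pop a (.caseOf N i (M.lift 0)))
  | prefixPush (P : Tm Loc Ch) (a : Loc) (N : Tm Loc Ch) (i : Ch) (M : Tm Loc Ch) :
      Step (.caseOf (.push P a N) i M) (.push P a (.caseOf N i M))
  | assoc (P : Tm Loc Ch) (i : Ch) (N M : Tm Loc Ch) :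
      Step (.caseOf (.caseOf P i N) i M) (.caseOf P i (.caseOf N i M))
  | unroll (M : Tm Loc Ch) (i : Ch) :
      Step (.loop M i) (.caseOf M i (.loop M i))
  | push_left (N N' : Tm Loc Ch) (a : Loc) (M : Tm Loc Ch) :
      Step N N' → Step (.push N a M) (.push N' a M)
  | push_right (N : Tm Loc Ch) (a : Loc) (M M' : Tm Loc Ch) :
      Step M M' → Step (.push N a M) (.push N a M')
  | pop_body (a : Loc) (M M' : Tm Loc Ch) :
      Step M M' → Step (.pop a M) (.pop a M')
  | case_left (M M' : Tm Loc Ch) (i : Ch) (N : Tm Loc Ch) :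
      Step M M' → Step (.caseOf M i N) (.caseOf M' i N)
  | case_right (M : Tm Loc Ch) (i : Ch) (N N' : Tm Loc Ch) :
      Step N N' → Step (.caseOf M i N) (.caseOf M i N')
  | loop_body (M M' : Tm Loc Ch) (i : Ch) :
      Step M M' → Step (.loop M i) (.loop M' i)

variable [DecidableEq Ch]

/-- Types `!!s => !!t_I`: an implication from a memory type (family of stack
types indexed by locations) to a sum type (family of memory types indexed
by a set of choices, represented via `Option`). -/
inductive Ty (Loc Ch : Type) : Type where
  | arr : (Loc → List (Ty Loc Ch)) → (Ch → Option (Loc → List (Ty Loc Ch))) → Ty Loc Ch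

/-- Stack types: lists of types (head = top of stack). -/
abbrev StackTy (Loc Ch : Type) := List (Ty Loc Ch)

/-- Memory types: families of stack types indexed by locations. -/
abbrev MemTy (Loc Ch : Type) := Loc → StackTy Loc Ch

/-- Sum types: families of memory types indexed by a set of choices
(`T i = some m` means `i` is in the index set with memory type `m`). -/
abbrev SumTy (Loc Ch : Type) := Ch → Option (MemTy Loc Ch)

/-- The empty memory type `ε`. -/
def memNil : MemTy Loc Ch := fun _ => []

/-- `memCons a r s` is `a(r)·!!s`: push the type `r` on top at location `a`. -/
def memCons [DecidableEq Loc] (a : Loc) (r : Ty Loc Ch) (s : MemTy Loc Ch) : MemTy Loc Ch :=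
  Function.update s a (r :: s a)

/-- Pointwise concatenation of memory types (`r` on top of `s`). -/
def memApp (r s : MemTy Loc Ch) : MemTy Loc Ch := fun a => r a ++ s a

/-- The singleton sum type `!!m.i`. -/
def sumSingle [DecidableEq Ch] (i : Ch) (m : MemTy Loc Ch) : SumTy Loc Ch :=
  fun j => if j = i then some m else none

/-- Stack expansion of a sum type: place `s` underneath every summand. -/
def sumExpand (s : MemTy Loc Ch) (T : SumTy Loc Ch) : SumTy Loc Ch :=
  fun i => (T i).map fun m => memApp m s

/-- `sumOver S T` is the sum `!!s_I + !!t_{J∖I}`: `S` overriding `T`. -/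
def sumOver (S T : SumTy Loc Ch) : SumTy Loc Ch :=
  fun i => match S i with
    | some m => some m
    | none => T i

variable [DecidableEq Loc] [DecidableEq Ch]

/-- The typing judgement `Γ ⊢ M : t` of the simply-typed FMC with control,
with de Bruijn contexts (lists of types). -/
inductive Typing : List (Ty Loc Ch) → Tm Loc Ch → Ty Loc Ch → Prop where
  | var (Γ : List (Ty Loc Ch)) (n : ℕ) (t : Ty Loc Ch) (h : Γ[n]? = some t) :
      Typing Γ (.var n) t
  | choice (Γ : List (Ty Loc Ch)) (i : Ch) :
      Typing Γ (.choice i) (.arr memNil (sumSingle i memNil))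
  | push (Γ : List (Ty Loc Ch)) (N : Tm Loc Ch) (r : Ty Loc Ch) (a : Loc)
      (M : Tm Loc Ch) (s : MemTy Loc Ch) (T : SumTy Loc Ch) :
      Typing Γ N r → Typing Γ M (.arr (memCons a r s) T) →
      Typing Γ (.push N a M) (.arr s T)
  | pop (Γ : List (Ty Loc Ch)) (r : Ty Loc Ch) (a : Loc) (M : Tm Loc Ch)
      (s : MemTy Loc Ch) (T : SumTy Loc Ch) :
      Typing (r :: Γ) M (.arr s T) →
      Typing Γ (.pop a M) (.arr (memCons a r s) T)
  | caseOf (Γ : List (Ty Loc Ch)) (M N : Tm Loc Ch) (i : Ch)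
      (r s : MemTy Loc Ch) (T : SumTy Loc Ch) :
      Typing Γ M (.arr r (Function.update T i (some s))) →
      Typing Γ N (.arr s T) →
      Typing Γ (.caseOf M i N) (.arr r T)
  | loop (Γ : List (Ty Loc Ch)) (M : Tm Loc Ch) (i : Ch)
      (s : MemTy Loc Ch) (T : SumTy Loc Ch) (h : T i = none) :
      Typing Γ M (.arr s (Function.update T i (some s))) →
      Typing Γ (.loop M i) (.arr s T)
  | expand (Γ : List (Ty Loc Ch)) (M : Tm Loc Ch)
      (r s : MemTy Loc Ch) (T : SumTy Loc Ch) :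
      Typing Γ M (.arr r T) →
      Typing Γ M (.arr (memApp r s) (sumExpand s T))
  | incl (Γ : List (Ty Loc Ch)) (M : Tm Loc Ch) (r : MemTy Loc Ch)
      (T U : SumTy Loc Ch) (h : ∀ i, T i = none ∨ U i = none) :
      Typing Γ M (.arr r T) →
      Typing Γ M (.arr r (sumOver T U))

/-- A type is OK if it conforms to the grammar (all memory types and sum
types are finitely supported) and is zero-free (every sum type occurring in
it is indexed by a nonempty set of choices). -/
inductive TyOK : Ty Loc Ch → Prop where
  | arr (s : MemTy Loc Ch) (T : SumTy Loc Ch)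
      (hs1 : {a | s a ≠ []}.Finite)
      (hs2 : ∀ a, ∀ t ∈ s a, TyOK t)
      (hT0 : ∃ i, T i ≠ none)
      (hT1 : {i | T i ≠ none}.Finite)
      (hT2 : ∀ i m, T i = some m → {a | m a ≠ []}.Finite)
      (hT3 : ∀ i m, T i = some m → ∀ a, ∀ t ∈ m a, TyOK t) :
      TyOK (.arr s T)

/-- The typing judgement `Γ ⊢ M : t` restricted so that every type occurring
in the derivation is OK (in particular, every sum type occurring in the
derivation is indexed by a nonempty finite set of choices). -/
inductive TypingOK : List (Ty Loc Ch) → Tm Loc Ch → Ty Loc Ch → Prop where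
  | var (Γ : List (Ty Loc Ch)) (n : ℕ) (t : Ty Loc Ch) (h : Γ[n]? = some t)
      (hok : TyOK t) :
      TypingOK Γ (.var n) t
  | choice (Γ : List (Ty Loc Ch)) (i : Ch)
      (hok : TyOK (Ty.arr memNil (sumSingle i memNil) : Ty Loc Ch)) :
      TypingOK Γ (.choice i) (.arr memNil (sumSingle i memNil))
  | push (Γ : List (Ty Loc Ch)) (N : Tm Loc Ch) (r : Ty Loc Ch) (a : Loc)
      (M : Tm Loc Ch) (s : MemTy Loc Ch) (T : SumTy Loc Ch)
      (hok : TyOK (Ty.arr s T)) :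
      TypingOK Γ N r → TypingOK Γ M (.arr (memCons a r s) T) →
      TypingOK Γ (.push N a M) (.arr s T)
  | pop (Γ : List (Ty Loc Ch)) (r : Ty Loc Ch) (a : Loc) (M : Tm Loc Ch)
      (s : MemTy Loc Ch) (T : SumTy Loc Ch)
      (hok : TyOK (Ty.arr (memCons a r s) T)) :
      TypingOK (r :: Γ) M (.arr s T) →
      TypingOK Γ (.pop a M) (.arr (memCons a r s) T)
  | caseOf (Γ : List (Ty Loc Ch)) (M N : Tm Loc Ch) (i : Ch)
      (r s : MemTy Loc Ch) (T : SumTy Loc Ch)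
      (hok : TyOK (Ty.arr r T)) :
      TypingOK Γ M (.arr r (Function.update T i (some s))) →
      TypingOK Γ N (.arr s T) →
      TypingOK Γ (.caseOf M i N) (.arr r T)
  | loop (Γ : List (Ty Loc Ch)) (M : Tm Loc Ch) (i : Ch)
      (s : MemTy Loc Ch) (T : SumTy Loc Ch) (h : T i = none)
      (hok : TyOK (Ty.arr s T)) :
      TypingOK Γ M (.arr s (Function.update T i (some s))) →
      TypingOK Γ (.loop M i) (.arr s T)
  | expand (Γ : List (Ty Loc Ch)) (M : Tm Loc Ch)
      (r s : MemTy Loc Ch) (T : SumTy Loc Ch)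
      (hok : TyOK (Ty.arr (memApp r s) (sumExpand s T))) :
      TypingOK Γ M (.arr r T) →
      TypingOK Γ M (.arr (memApp r s) (sumExpand s T))
  | incl (Γ : List (Ty Loc Ch)) (M : Tm Loc Ch) (r : MemTy Loc Ch)
      (T U : SumTy Loc Ch) (h : ∀ i, T i = none ∨ U i = none)
      (hok : TyOK (Ty.arr r (sumOver T U))) :
      TypingOK Γ M (.arr r T) →
      TypingOK Γ M (.arr r (sumOver T U))


/-! ### De Bruijn lemmas -/

theorem Tm.lift_lift' (M : Tm Loc Ch) : ∀ d e : ℕ, d ≤ e →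
    (M.lift d).lift (e + 1) = (M.lift e).lift d := by
  induction M with
  | var n => intro d e h; grind [Tm.lift]
  | push N a M ih1 ih2 => intro d e h; simp [Tm.lift, ih1 d e h, ih2 d e h]
  | pop a M ih => intro d e h; simp [Tm.lift, ih (d+1) (e+1) (by omega)]
  | choice i => intro d e h; simp [Tm.lift]
  | caseOf M i N ih1 ih2 => intro d e h; simp [Tm.lift, ih1 d e h, ih2 d e h]
  | loop M i ih => intro d e h; simp [Tm.lift, ih d e h]

theorem Tm.lift_subst_ge (M : Tm Loc Ch) : ∀ (k d : ℕ) (N : Tm Loc Ch), k ≤ d →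
    (M.subst k N).lift d = (M.lift (d + 1)).subst k (N.lift d) := by
  induction M with
  | var n => intro k d N h; grind [Tm.lift, Tm.subst]
  | push P a M ih1 ih2 => intro k d N h; simp [Tm.lift, Tm.subst, ih1 k d N h, ih2 k d N h]
  | pop a M ih =>
    intro k d N h
    simp [Tm.lift, Tm.subst, ih (k+1) (d+1) _ (by omega), Tm.lift_lift' N 0 d (by omega)]
  | choice i => intro k d N h; simp [Tm.lift, Tm.subst]
  | caseOf M i P ih1 ih2 => intro k d N h; simp [Tm.lift, Tm.subst, ih1 k d N h, ih2 k d N h]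
  | loop M i ih => intro k d N h; simp [Tm.lift, Tm.subst, ih k d N h]

theorem Tm.lift_subst_le (M : Tm Loc Ch) : ∀ (k d : ℕ) (N : Tm Loc Ch), d ≤ k →
    (M.lift d).subst (k + 1) (N.lift d) = (M.subst k N).lift d := by
  induction M with
  | var n => intro k d N h; grind [Tm.lift, Tm.subst]
  | push P a M ih1 ih2 => intro k d N h; simp [Tm.lift, Tm.subst, ih1 k d N h, ih2 k d N h]
  | pop a M ih =>
    intro k d N h
    simp [Tm.lift, Tm.subst, ← ih (k+1) (d+1) _ (by omega : d + 1 ≤ k + 1),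
      Tm.lift_lift' N 0 d (by omega)]
  | choice i => intro k d N h; simp [Tm.lift, Tm.subst]
  | caseOf M i P ih1 ih2 => intro k d N h; simp [Tm.lift, Tm.subst, ih1 k d N h, ih2 k d N h]
  | loop M i ih => intro k d N h; simp [Tm.lift, Tm.subst, ih k d N h]

theorem Tm.lift_subst_cancel (M : Tm Loc Ch) : ∀ (k : ℕ) (N : Tm Loc Ch),
    (M.lift k).subst k N = M := by
  induction M with
  | var n => intro k N; grind [Tm.lift, Tm.subst]
  | push P a M ih1 ih2 => intro k N; simp [Tm.lift, Tm.subst, ih1, ih2]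
  | pop a M ih => intro k N; simp [Tm.lift, Tm.subst, ih]
  | choice i => intro k N; simp [Tm.lift, Tm.subst]
  | caseOf M i P ih1 ih2 => intro k N; simp [Tm.lift, Tm.subst, ih1, ih2]
  | loop M i ih => intro k N; simp [Tm.lift, Tm.subst, ih]

theorem Tm.subst_subst (M : Tm Loc Ch) : ∀ (j k : ℕ) (N P : Tm Loc Ch), j ≤ k →
    (M.subst j N).subst k P = (M.subst (k + 1) (P.lift j)).subst j (N.subst k P) := by
  induction M with
  | var n =>
    intro j k N P h
    have := Tm.lift_subst_cancel P j (N.subst k P)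
    grind [Tm.subst]
  | push Q a M ih1 ih2 => intro j k N P h; simp [Tm.subst, ih1 j k N P h, ih2 j k N P h]
  | pop a M ih =>
    intro j k N P h
    simp [Tm.subst, ih (j+1) (k+1) _ _ (by omega : j + 1 ≤ k + 1),
      Tm.lift_lift' P 0 j (by omega), Tm.lift_subst_le N k 0 P (by omega)]
  | choice i => intro j k N P h; simp [Tm.subst]
  | caseOf M i Q ih1 ih2 => intro j k N P h; simp [Tm.subst, ih1 j k N P h, ih2 j k N P h]
  | loop M i ih => intro j k N P h; simp [Tm.subst, ih j k N P h]

/-- Lifting of a parallel substitution under a binder. -/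
def upS (σ : ℕ → Tm Loc Ch) : ℕ → Tm Loc Ch
  | 0 => .var 0
  | n + 1 => (σ n).lift 0

/-- Parallel substitution. -/
def Tm.inst : Tm Loc Ch → (ℕ → Tm Loc Ch) → Tm Loc Ch
  | .var n, σ => σ n
  | .push N a M, σ => .push (N.inst σ) a (M.inst σ)
  | .pop a M, σ => .pop a (M.inst (upS σ))
  | .choice i, _ => .choice i
  | .caseOf M i N, σ => .caseOf (M.inst σ) i (N.inst σ)
  | .loop M i, σ => .loop (M.inst σ) i

theorem Tm.inst_var (M : Tm Loc Ch) : M.inst Tm.var = M := by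
  have hup : upS (Tm.var : ℕ → Tm Loc Ch) = Tm.var := by
    funext n; cases n <;> simp [upS, Tm.lift]
  induction M with
  | pop a M ih => simp [Tm.inst, hup, ih]
  | _ => simp_all [Tm.inst]

theorem Tm.inst_subst (M : Tm Loc Ch) : ∀ (σ : ℕ → Tm Loc Ch) (k : ℕ) (N : Tm Loc Ch),
    (M.inst σ).subst k N = M.inst (fun n => (σ n).subst k N) := by
  induction M with
  | pop a M ih =>
    intro σ k N
    simp only [Tm.inst, Tm.subst, ih]
    congr 2
    funext n
    cases n with
    | zero => simp [upS, Tm.subst]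
    | succ n => simp [upS, Tm.lift_subst_le (σ n) k 0 N (by omega)]
  | _ => intros; simp_all [Tm.inst, Tm.subst]

/-- Extension of a parallel substitution by a term. -/
def consS (N : Tm Loc Ch) (σ : ℕ → Tm Loc Ch) : ℕ → Tm Loc Ch
  | 0 => N
  | n + 1 => σ n

theorem Tm.inst_up_subst (M : Tm Loc Ch) (σ : ℕ → Tm Loc Ch) (N : Tm Loc Ch) :
    (M.inst (upS σ)).subst 0 N = M.inst (consS N σ) := by
  rw [Tm.inst_subst]
  congr 1
  funext n
  cases n with
  | zero => simp [upS, consS, Tm.subst]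
  | succ n => simp [upS, consS, Tm.lift_subst_cancel]

/-! ### Parallel reduction; the flag records a beta (or unroll) step -/

inductive Par : Bool → Tm Loc Ch → Tm Loc Ch → Prop where
  | var (n : ℕ) : Par false (.var n) (.var n)
  | choice (i : Ch) : Par false (.choice i) (.choice i)
  | push {b c N N' M M'} (a : Loc) : Par b N N' → Par c M M' →
      Par (b || c) (.push N a M) (.push N' a M')
  | pop {b M M'} (a : Loc) : Par b M M' → Par b (.pop a M) (.pop a M')
  | caseOf {b c M M' N N'} (i : Ch) : Par b M M' → Par c N N' →
      Par (b || c) (.caseOf M i N) (.caseOf M' i N')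
  | loop (b : Bool) (M : Tm Loc Ch) (i : Ch) (X : Tm Loc Ch) : Par b (.loop M i) X
  | beta {N N' M M'} (b : Bool) (a : Loc) : Par false N N' → Par false M M' →
      Par b (.push N a (.pop a M)) (M'.subst 0 N')
  | passage {N N' M M'} (a b : Loc) (h : a ≠ b) : Par false N N' → Par false M M' →
      Par false (.push N b (.pop a M)) (.pop a (.push (N'.lift 0) b M'))
  | select {M M'} (i : Ch) : Par false M M' → Par false (.caseOf (.choice i) i M) M'
  | reject (i j : Ch) (M : Tm Loc Ch) (h : i ≠ j) :
      Par false (.caseOf (.choice i) j M) (.choice i)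
  | prefixPop {N N' M M'} (a : Loc) (i : Ch) : Par false N N' → Par false M M' →
      Par false (.caseOf (.pop a N) i M) (.pop a (.caseOf N' i (M'.lift 0)))
  | prefixPush {P P' N N' M M'} (a : Loc) (i : Ch) : Par false P P' → Par false N N' →
      Par false M M' →
      Par false (.caseOf (.push P a N) i M) (.push P' a (.caseOf N' i M'))
  | assoc {P P' N N' M M'} (i : Ch) : Par false P P' → Par false N N' →
      Par false M M' →
      Par false (.caseOf (.caseOf P i N) i M) (.caseOf P' i (.caseOf N' i M'))

theorem Par.weaken {b : Bool} {M M' : Tm Loc Ch} (h : Par b M M') : Par false M M' := by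
  induction h with
  | push a _ _ ih1 ih2 => exact Par.push a ih1 ih2
  | caseOf a _ _ ih1 ih2 => exact Par.caseOf a ih1 ih2
  | pop a _ ih => exact Par.pop a ih
  | beta b a h1 h2 => exact Par.beta _ a h1 h2
  | loop => exact Par.loop _ _ _ _
  | _ => constructor <;> assumption

theorem Par.refl (M : Tm Loc Ch) : Par false M M := by
  induction M with
  | var n => exact .var n
  | push N a M ih1 ih2 => exact Par.push a ih1 ih2
  | caseOf M i N ih1 ih2 => exact Par.caseOf i ih1 ih2
  | pop a M ih => exact .pop a ih
  | choice i => exact .choice i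
  | loop => exact Par.loop _ _ _ _

theorem Par.lift {b : Bool} {M M' : Tm Loc Ch} (h : Par b M M') :
    ∀ d, Par b (M.lift d) (M'.lift d) := by
  induction h with
  | var n => intro d; exact Par.refl _
  | choice i => intro d; exact Par.refl _
  | push a _ _ ih1 ih2 => intro d; exact Par.push a (ih1 d) (ih2 d)
  | caseOf a _ _ ih1 ih2 => intro d; exact Par.caseOf a (ih1 d) (ih2 d)
  | pop a _ ih => intro d; exact Par.pop a (ih _)
  | loop => intro d; exact Par.loop _ _ _ _
  | beta b a h1 h2 ih1 ih2 =>
    intro d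
    rw [Tm.lift_subst_ge _ 0 d _ (by omega)]
    exact Par.beta b a (ih1 d) (ih2 (d+1))
  | @passage N N' M M' a b h _ _ ih1 ih2 =>
    intro d
    have := Par.passage a b h (ih1 d) (ih2 (d+1))
    rw [← Tm.lift_lift' N' 0 d (by omega)] at this
    exact this
  | select i _ ih => intro d; exact Par.select i (ih d)
  | reject i j M h => intro d; exact Par.reject i j _ h
  | @prefixPop N N' M M' a i _ _ ih1 ih2 =>
    intro d
    have := Par.prefixPop a i (ih1 (d+1)) (ih2 d)
    rw [← Tm.lift_lift' M' 0 d (by omega)] at this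
    exact this
  | prefixPush a i _ _ _ ih1 ih2 ih3 =>
    intro d; exact Par.prefixPush a i (ih1 d) (ih2 d) (ih3 d)
  | assoc i _ _ _ ih1 ih2 ih3 => intro d; exact Par.assoc i (ih1 d) (ih2 d) (ih3 d)

theorem Par.subst {b : Bool} {M M' : Tm Loc Ch} (h : Par b M M') :
    ∀ (k : ℕ) (P P' : Tm Loc Ch), Par false P P' → Par b (M.subst k P) (M'.subst k P') := by
  induction h with
  | var n =>
    intro k P P' hP
    simp only [Tm.subst]
    split_ifs
    · exact hP
    · exact .var _
    · exact .var _
  | choice i => intro k P P' hP; exact .choice i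
  | push a _ _ ih1 ih2 => intro k P P' hP; exact Par.push a (ih1 k P P' hP) (ih2 k P P' hP)
  | caseOf a _ _ ih1 ih2 => intro k P P' hP; exact Par.caseOf a (ih1 k P P' hP) (ih2 k P P' hP)
  | pop a _ ih => intro k P P' hP; exact Par.pop a (ih _ _ _ (hP.lift 0))
  | loop => intro k P P' hP; exact Par.loop _ _ _ _
  | beta b a h1 h2 ih1 ih2 =>
    intro k P P' hP
    rw [Tm.subst_subst _ 0 k _ _ (by omega)]
    exact Par.beta b a (ih1 k P P' hP) (ih2 (k+1) _ _ (hP.lift 0))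
  | @passage N N' M M' a b h _ _ ih1 ih2 =>
    intro k P P' hP
    have := Par.passage a b h (ih1 k P P' hP) (ih2 (k+1) _ _ (hP.lift 0))
    rw [← Tm.lift_subst_le N' k 0 P' (by omega)] at this
    exact this
  | select i _ ih => intro k P P' hP; exact Par.select i (ih k P P' hP)
  | reject i j M h => intro k P P' hP; exact Par.reject i j _ h
  | @prefixPop N N' M M' a i _ _ ih1 ih2 =>
    intro k P P' hP
    have := Par.prefixPop a i (ih1 (k+1) _ _ (hP.lift 0)) (ih2 k P P' hP)
    rw [← Tm.lift_subst_le M' k 0 P' (by omega)] at this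
    exact this
  | prefixPush a i _ _ _ ih1 ih2 ih3 =>
    intro k P P' hP
    exact Par.prefixPush a i (ih1 k P P' hP) (ih2 k P P' hP) (ih3 k P P' hP)
  | assoc i _ _ _ ih1 ih2 ih3 =>
    intro k P P' hP; exact Par.assoc i (ih1 k P P' hP) (ih2 k P P' hP) (ih3 k P P' hP)

def Tm.meas : Tm Loc Ch → ℕ
  | .var _ => 1
  | .push N _ M => N.meas + 2 * M.meas
  | .pop _ M => M.meas + 1
  | .choice _ => 1
  | .caseOf M _ N => M.meas * (N.meas + 1)
  | .loop M _ => M.meas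

theorem Tm.meas_pos (M : Tm Loc Ch) : 0 < M.meas := by
  induction M with
  | caseOf M i N ih1 ih2 => simp only [Tm.meas]; positivity
  | _ => simp only [Tm.meas]; omega

theorem Tm.meas_lift (M : Tm Loc Ch) : ∀ d, (M.lift d).meas = M.meas := by
  induction M with
  | var n => intro d; simp only [Tm.lift]; split_ifs <;> rfl
  | _ => intros; simp_all [Tm.lift, Tm.meas]

theorem Step.par {M M' : Tm Loc Ch} (h : Step M M') :
    Par true M M' ∨ (Par false M M' ∧ M'.meas < M.meas) := by
  induction h with
  | beta N a M => exact .inl (.beta _ a (.refl N) (.refl M))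
  | passage N a b M h =>
    refine .inr ⟨.passage a b h (.refl N) (.refl M), ?_⟩
    simp only [Tm.meas, Tm.meas_lift]; omega
  | select i M => exact .inr ⟨.select i (.refl M), by simp [Tm.meas]⟩
  | reject i j M h => exact .inr ⟨.reject i j M h, by have := M.meas_pos; simp [Tm.meas]; omega⟩
  | prefixPop a N i M =>
    refine .inr ⟨.prefixPop a i (.refl N) (.refl M), ?_⟩
    have := M.meas_pos
    simp only [Tm.meas, Tm.meas_lift]; nlinarith
  | prefixPush P a N i M =>
    refine .inr ⟨.prefixPush a i (.refl P) (.refl N) (.refl M), ?_⟩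
    have := mul_pos P.meas_pos M.meas_pos
    simp only [Tm.meas]; nlinarith
  | assoc P i N M =>
    refine .inr ⟨.assoc i (.refl P) (.refl N) (.refl M), ?_⟩
    have := mul_pos P.meas_pos M.meas_pos
    simp only [Tm.meas]; nlinarith
  | unroll M i => exact .inl (.loop _ _ _ _)
  | push_left N N' a M _ ih =>
    rcases ih with h | ⟨h, hm⟩
    · exact .inl (Par.push a h (.refl M))
    · exact .inr ⟨Par.push a h (.refl M), by simp only [Tm.meas]; omega⟩
  | push_right N a M M' _ ih =>
    rcases ih with h | ⟨h, hm⟩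
    · exact .inl (Par.push a (.refl N) h)
    · exact .inr ⟨Par.push a (.refl N) h, by simp only [Tm.meas]; omega⟩
  | pop_body a M M' _ ih =>
    rcases ih with h | ⟨h, hm⟩
    · exact .inl (Par.pop a h)
    · exact .inr ⟨Par.pop a h, by simp only [Tm.meas]; omega⟩
  | case_left M M' i N _ ih =>
    rcases ih with h | ⟨h, hm⟩
    · exact .inl (Par.caseOf i h (.refl N))
    · exact .inr ⟨Par.caseOf i h (.refl N), by simp only [Tm.meas]; nlinarith⟩
  | case_right M i N N' _ ih =>
    rcases ih with h | ⟨h, hm⟩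
    · exact .inl (Par.caseOf i (.refl M) h)
    · refine .inr ⟨Par.caseOf i (.refl M) h, ?_⟩
      have := M.meas_pos
      simp only [Tm.meas]; nlinarith
  | loop_body M M' i _ ih => exact .inl (.loop _ _ _ _)

/-! ### The machine -/

/-- `Pops a S N S'`: the topmost entry of `S` at location `a` is `N`, and `S'` is the rest. -/
inductive Pops (a : Loc) : List (Loc × Tm Loc Ch) → Tm Loc Ch → List (Loc × Tm Loc Ch) → Prop where
  | here (N : Tm Loc Ch) (S : List (Loc × Tm Loc Ch)) : Pops a ((a, N) :: S) N S
  | there (b : Loc) (P : Tm Loc Ch) {N : Tm Loc Ch} {S S' : List (Loc × Tm Loc Ch)}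
      (h : a ≠ b) : Pops a S N S' → Pops a ((b, P) :: S) N ((b, P) :: S')

inductive Run : ℕ → ℕ → List (Loc × Tm Loc Ch) → Tm Loc Ch → List (Ch × Tm Loc Ch) → Prop where
  | fin (S : List (Loc × Tm Loc Ch)) (i : Ch) : Run 0 0 S (.choice i) []
  | var {h n S' i K} (S : List (Loc × Tm Loc Ch)) (x : ℕ) :
      Run h n S' (.choice i) K → Run (h + 1) n S (.var x) K
  | push {h₁ h₂ n m S S' a N M K K'} :
      Run h₁ n ((a, N) :: S) M K → Run h₂ m S' N K' →
      Run (h₁ + h₂ + 1) (n + m) S (.push N a M) K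
  | pop {h n S S' a N M K} :
      Pops a S N S' → Run h n S' (M.subst 0 N) K → Run (h + 1) (n + 1) S (.pop a M) K
  | sel {h n S M K} (i : Ch) : Run h n S M K → Run (h + 1) n S (.choice i) ((i, M) :: K)
  | rej {h₁ h₂ n m S S' M K} (i j : Ch) (hij : i ≠ j) :
      Run h₁ n S (.choice i) K → Run h₂ m S' M K →
      Run (h₁ + h₂ + 1) (n + m) S (.choice i) ((j, M) :: K)
  | caseOf {h n S M i N K} :
      Run h n S M ((i, N) :: K) → Run (h + 1) n S (.caseOf M i N) K

/-- Pointwise parallel reduction of memories. -/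
def MPar (S S' : List (Loc × Tm Loc Ch)) : Prop :=
  List.Forall₂ (fun p q => p.1 = q.1 ∧ Par false p.2 q.2) S S'

theorem MPar.refl (S : List (Loc × Tm Loc Ch)) : MPar S S := by
  induction S with
  | nil => exact .nil
  | cons p S ih => exact .cons ⟨rfl, Par.refl _⟩ ih

inductive KPar : Bool → List (Ch × Tm Loc Ch) → List (Ch × Tm Loc Ch) → Prop where
  | nil : KPar false [] []
  | cons {b c M M' K K'} (i : Ch) : Par b M M' → KPar c K K' →
      KPar (b || c) ((i, M) :: K) ((i, M') :: K')
  | merge {c N N' M M' K K'} (i : Ch) : Par false N N' → Par false M M' → KPar c K K' →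
      KPar c ((i, N) :: (i, M) :: K) ((i, .caseOf N' i M') :: K')

theorem KPar.refl (K : List (Ch × Tm Loc Ch)) : KPar false K K := by
  induction K with
  | nil => exact .nil
  | cons p K ih => exact KPar.cons p.1 (Par.refl p.2) ih

theorem Pops.par {a : Loc} {S S' : List (Loc × Tm Loc Ch)} {N : Tm Loc Ch} (h : Pops a S N S') :
    ∀ {T}, MPar S T → ∃ N' T', Pops a T N' T' ∧ Par false N N' ∧ MPar S' T' := by
  induction h with
  | here N S =>
    intro T hT
    cases hT with
    | @cons _ q _ T' h1 h2 =>
      obtain ⟨b, N'⟩ := q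
      obtain ⟨h, h'⟩ := h1
      simp only at h h'
      subst h
      exact ⟨N', T', .here _ _, h', h2⟩
  | there b P hab _ ih =>
    intro T hT
    cases hT with
    | @cons _ q _ T' h1 h2 =>
      obtain ⟨b', N'⟩ := q
      obtain ⟨h, h'⟩ := h1
      simp only at h h'
      subst h
      obtain ⟨N'', T'', h3, h4, h5⟩ := ih h2
      exact ⟨N'', _, .there _ _ hab h3, h4, .cons ⟨rfl, h'⟩ h5⟩

set_option maxHeartbeats 2000000 in
/-- Simulation: parallel reduction does not increase the cost, and decreases it if flagged. -/
theorem Run.sim : ∀ (h n : ℕ) (S : List (Loc × Tm Loc Ch)) (M : Tm Loc Ch)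
    (K : List (Ch × Tm Loc Ch)), Run h n S M K →
    ∀ (b c : Bool) (S' : List (Loc × Tm Loc Ch)) (M' : Tm Loc Ch) (K' : List (Ch × Tm Loc Ch)),
    MPar S S' → Par b M M' → KPar c K K' →
    ∃ h' n', Run h' n' S' M' K' ∧ n' + (b || c).toNat ≤ n := by
  intro h
  induction h using Nat.strong_induction_on with
  | _ h IH =>
  intro n S M K hr b c S' M' K' hS hM hK
  cases hr with
  | fin i =>
    cases hM; cases hK
    exact ⟨_, _, .fin _ _, by simp⟩
  | @var h _ S1 i _ _ x hr =>
    cases hM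
    obtain ⟨h', n', h1, h2⟩ := IH h (by omega) _ _ _ _ hr false c _ _ _ (.refl _) (.choice i) hK
    exact ⟨_, _, .var _ _ h1, h2⟩
  | @push h₁ h₂ n m _ S1 a N M _ K1 hr1 hr2 =>
    cases hM with
    | @push b1 b2 _ N' _ M' _ hN hM =>
      obtain ⟨h', n', h1, h2⟩ := IH h₁ (by omega) _ _ _ _ hr1 b2 c _ _ _
        (.cons (b := (a, N')) ⟨rfl, hN.weaken⟩ hS) hM hK
      obtain ⟨h'', n'', h3, h4⟩ := IH h₂ (by omega) _ _ _ _ hr2 b1 false _ _ _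
        (.refl _) hN (.refl _)
      refine ⟨_, _, .push h1 h3, ?_⟩
      clear IH; cases b1 <;> cases b2 <;> cases c <;> simp only [Bool.or_false, Bool.or_true, Bool.toNat_false, Bool.toNat_true] at * <;> omega
    | @beta _ N' M M' _ _ hN hM =>
      cases hr1 with
      | @pop h₁ n _ S2 _ _ _ _ hp hr =>
        cases hp with
        | there _ _ hne => exact absurd rfl hne
        | here =>
          obtain ⟨h', n', h1, h2⟩ := IH h₁ (by omega) _ _ _ _ hr false c _ _ _ hS
            (hM.subst 0 _ _ hN) hK
          refine ⟨_, _, h1, ?_⟩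
          clear IH; cases b <;> cases c <;> simp only [Bool.or_false, Bool.or_true, Bool.toNat_false, Bool.toNat_true] at * <;> omega
    | @passage _ N' M M' a' _ hne hN hM =>
      cases hr1 with
      | @pop h₁ n _ S2 _ P _ _ hp hr =>
        cases hp with
        | here => exact absurd rfl hne
        | there _ _ _ hp =>
          obtain ⟨P', S3, h5, h6, h7⟩ := hp.par hS
          obtain ⟨h', n', h1, h2⟩ := IH h₁ (by omega) _ _ _ _ hr false c _ _ _
            (.cons (b := (a, N')) ⟨rfl, hN⟩ h7) (hM.subst 0 _ _ h6) hK
          obtain ⟨h'', n'', h3, h4⟩ := IH h₂ (by omega) _ _ _ _ hr2 false false _ _ _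
            (.refl _) hN (.refl _)
          refine ⟨h' + h'' + 1 + 1, n' + n'' + 1, .pop (N := P') h5 ?_, ?_⟩
          · simp only [Tm.subst, Tm.lift_subst_cancel]
            exact .push h1 h3
          · clear IH; cases c <;> simp only [Bool.or_false, Bool.or_true, Bool.toNat_false, Bool.toNat_true] at * <;> omega
  | @pop h n _ S1 a N M _ hp hr =>
    cases hM with
    | pop _ hM =>
      obtain ⟨P', S3, h5, h6, h7⟩ := hp.par hS
      obtain ⟨h', n', h1, h2⟩ := IH h (by omega) _ _ _ _ hr b c _ _ _ h7 (hM.subst 0 _ _ h6) hK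
      exact ⟨_, _, .pop h5 h1, by omega⟩
  | @sel h n _ M K i hr =>
    cases hM
    cases hK with
    | @cons b c _ M' _ K' _ hM hK =>
      obtain ⟨h', n', h1, h2⟩ := IH h (by omega) _ _ _ _ hr b c _ _ _ hS hM hK
      exact ⟨_, _, .sel _ h1, by simpa using h2⟩
    | @merge _ _ _ M N K K' _ hN hM hK =>
      obtain ⟨h', n', h1, h2⟩ := IH h (by omega) _ _ _ _ hr false c _ _ _ hS hN
        (KPar.cons i hM hK)
      exact ⟨_, _, .sel _ (.caseOf h1), by simpa using h2⟩
  | @rej h₁ h₂ n m _ S1 M K i j hij hr1 hr2 =>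
    cases hM
    cases hK with
    | @cons b c _ M' _ K' _ hM hK =>
      obtain ⟨h', n', h1, h2⟩ := IH h₁ (by omega) _ _ _ _ hr1 false c _ _ _ hS (.choice i) hK
      obtain ⟨h'', n'', h3, h4⟩ := IH h₂ (by omega) _ _ _ _ hr2 b c _ _ _ (.refl _) hM hK
      refine ⟨_, _, .rej _ _ hij h1 h3, ?_⟩
      clear IH; cases b <;> cases c <;> simp only [Bool.or_false, Bool.or_true, Bool.toNat_false, Bool.toNat_true] at * <;> omega
    | @merge _ _ _ M N K K' _ hN hM hK =>
      obtain ⟨h'', n'', h3, h4⟩ := IH h₂ (by omega) _ _ _ _ hr2 false c _ _ _ (.refl _) hN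
        (KPar.cons j hM hK)
      cases hr1 with
      | sel => exact absurd rfl hij
      | @rej h₃ h₄ _ _ _ _ _ _ _ _ _ hr3 hr4 =>
        obtain ⟨h', n', h1, h2⟩ := IH h₃ (by omega) _ _ _ _ hr3 false c _ _ _ hS (.choice i) hK
        refine ⟨_, _, .rej _ _ hij h1 (.caseOf h3), ?_⟩
        clear IH; cases c <;> simp only [Bool.or_false, Bool.or_true, Bool.toNat_false, Bool.toNat_true] at * <;> omega
  | @caseOf h _ _ M i N _ hr =>
    cases hM with
    | @caseOf b1 b2 _ _ _ _ _ hM hN =>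
      obtain ⟨h', n', h1, h2⟩ := IH h (by omega) _ _ _ _ hr b1 _ _ _ _ hS hM (.cons i hN hK)
      exact ⟨_, _, .caseOf h1, by rw [Bool.or_assoc]; exact h2⟩
    | select _ hN =>
      cases hr with
      | rej _ _ hij => exact absurd rfl hij
      | @sel h _ _ _ _ _ hr =>
        obtain ⟨h', n', h1, h2⟩ := IH h (by omega) _ _ _ _ hr _ _ _ _ _ hS hN hK
        exact ⟨_, _, h1, h2⟩
    | reject j _ _ hij =>
      cases hr with
      | sel => exact absurd rfl hij
      | @rej h₁ h₂ _ _ _ _ _ _ _ _ _ hr1 hr2 =>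
        obtain ⟨h', n', h1, h2⟩ := IH h₁ (by omega) _ _ _ _ hr1 _ _ _ _ _ hS (.choice j) hK
        exact ⟨_, _, h1, by omega⟩
    | @prefixPop _ N' _ M' a _ hN hM =>
      cases hr with
      | @pop h n _ S2 _ P _ _ hp hr =>
        obtain ⟨P', S3, h5, h6, h7⟩ := hp.par hS
        obtain ⟨h', n', h1, h2⟩ := IH h (by omega) _ _ _ _ hr _ _ _ _ _ h7
          (hN.subst 0 _ _ h6) (.cons i hM hK)
        refine ⟨h' + 1 + 1, n' + 1, .pop (N := P') h5 ?_, ?_⟩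
        · simp only [Tm.subst, Tm.lift_subst_cancel]
          exact .caseOf h1
        · clear IH; simp at h2 ⊢; omega
    | @prefixPush _ P' _ N' _ M' a _ hP hN hM =>
      cases hr with
      | @push h₁ h₂ n m _ S1 _ _ _ _ K1 hr1 hr2 =>
        obtain ⟨h', n', h1, h2⟩ := IH h₁ (by omega) _ _ _ _ hr1 _ _ _ _ _
          (.cons (b := (a, P')) ⟨rfl, hP⟩ hS) hN (.cons i hM hK)
        obtain ⟨h'', n'', h3, h4⟩ := IH h₂ (by omega) _ _ _ _ hr2 _ _ _ _ _
          (.refl _) hP (.refl _)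
        refine ⟨_, _, .push (.caseOf h1) h3, ?_⟩
        clear IH; simp at h2 h4 ⊢; omega
    | @assoc _ P' _ N' _ M' _ hP hN hM =>
      cases hr with
      | @caseOf h _ _ _ _ _ _ hr =>
        obtain ⟨h', n', h1, h2⟩ := IH h (by omega) _ _ _ _ hr _ _ _ _ _ hS hP
          (.merge i hN hM hK)
        exact ⟨_, _, .caseOf h1, h2⟩

theorem Run.no_infinite (n : ℕ) : ∀ (m : ℕ) (h : ℕ) (S : List (Loc × Tm Loc Ch))
    (K : List (Ch × Tm Loc Ch)) (f : ℕ → Tm Loc Ch), (f 0).meas = m →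
    Run h n S (f 0) K → (∀ k, Step (f k) (f (k + 1))) → False := by
  induction n using Nat.strong_induction_on with
  | _ n IHn =>
  intro m
  induction m using Nat.strong_induction_on with
  | _ m IHm =>
  intro h S K f hm hr hf
  rcases (hf 0).par with hp | ⟨hp, hlt⟩
  · obtain ⟨h', n', h1, h2⟩ := Run.sim _ _ _ _ _ hr _ _ _ _ _ (.refl _) hp (.refl _)
    simp at h2
    exact IHn n' (by omega) _ h' S K (fun k => f (k + 1)) rfl h1 (fun k => hf (k + 1))
  · obtain ⟨h', n', h1, h2⟩ := Run.sim _ _ _ _ _ hr _ _ _ _ _ (.refl _) hp (.refl _)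
    simp at h2
    rcases Nat.lt_or_ge n' n with hn | hn
    · exact IHn n' hn _ h' S K (fun k => f (k + 1)) rfl h1 (fun k => hf (k + 1))
    · obtain rfl : n' = n := by omega
      exact IHm _ (hm ▸ hlt) h' S K (fun k => f (k + 1)) rfl h1 (fun k => hf (k + 1))

/-! ### Reducibility -/

/-- The stack stored at location `a`. -/
def proj (a : Loc) : List (Loc × Tm Loc Ch) → List (Tm Loc Ch)
  | [] => []
  | (b, N) :: S => if a = b then N :: proj a S else proj a S

mutual
def Red : Ty Loc Ch → Tm Loc Ch → Prop
  | .arr s T, M => ∀ (F : Loc → List (Tm Loc Ch)) (S : List (Loc × Tm Loc Ch))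
      (K : List (Ch × Tm Loc Ch)),
      (∀ a, ∃ L, proj a S = L ++ F a ∧ RedL (s a) L) →
      (∀ i, RedO (T i) F i K) → ∃ h n, Run h n S M K
def RedL : List (Ty Loc Ch) → List (Tm Loc Ch) → Prop
  | [], L => L = []
  | t :: ts, L => ∃ N L', L = N :: L' ∧ Red t N ∧ RedL ts L'
def RedO : Option (Loc → List (Ty Loc Ch)) → (Loc → List (Tm Loc Ch)) → Ch →
    List (Ch × Tm Loc Ch) → Prop
  | none, _, _, _ => True
  | some m, F, i, K => ∀ S : List (Loc × Tm Loc Ch),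
      (∀ a, ∃ L, proj a S = L ++ F a ∧ RedL (m a) L) → ∃ h n, Run h n S (.choice i) K
end

/-- `S` consists of reducible stacks of type `s` on top of the frame `F`. -/
def RedM (s : MemTy Loc Ch) (F : Loc → List (Tm Loc Ch)) (S : List (Loc × Tm Loc Ch)) : Prop :=
  ∀ a, ∃ L, proj a S = L ++ F a ∧ RedL (s a) L

def RedK (T : SumTy Loc Ch) (F : Loc → List (Tm Loc Ch)) (K : List (Ch × Tm Loc Ch)) : Prop :=
  ∀ i m, T i = some m → ∀ S, RedM m F S → ∃ h n, Run h n S (.choice i) K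

theorem red_arr (s : MemTy Loc Ch) (T : SumTy Loc Ch) (M : Tm Loc Ch) :
    Red (.arr s T) M ↔ ∀ F S K, RedM s F S → RedK T F K → ∃ h n, Run h n S M K := by
  have : ∀ F K, (∀ i, RedO (T i) F i K) ↔ RedK T F K := by
    intro F K
    refine forall_congr' fun i => ?_
    cases hT : T i with
    | none => simp [RedO]
    | some m => simp [RedO, RedM]
  simp only [Red, RedM, this]

theorem redL_append (s t : List (Ty Loc Ch)) : ∀ L, RedL (s ++ t) L →
    ∃ L1 L2, L = L1 ++ L2 ∧ RedL s L1 ∧ RedL t L2 := by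
  induction s with
  | nil => intro L h; exact ⟨[], L, rfl, by simp [RedL], h⟩
  | cons r s ih =>
    intro L h
    simp only [List.cons_append, RedL] at h
    obtain ⟨N, L', rfl, h1, h2⟩ := h
    obtain ⟨L1, L2, rfl, h3, h4⟩ := ih _ h2
    exact ⟨N :: L1, L2, rfl, by simp only [RedL]; exact ⟨_, _, rfl, h1, h3⟩, h4⟩

theorem redL_append' (s t : List (Ty Loc Ch)) : ∀ L1 L2, RedL s L1 → RedL t L2 →
    RedL (s ++ t) (L1 ++ L2) := by
  induction s with
  | nil => intro L1 L2 h1 h2; simp only [RedL] at h1; subst h1; exact h2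
  | cons r s ih =>
    intro L1 L2 h1 h2
    simp only [RedL] at h1
    obtain ⟨N, L', rfl, h1, h3⟩ := h1
    simp only [List.cons_append, RedL]
    exact ⟨_, _, rfl, h1, ih _ _ h3 h2⟩

theorem proj_append (a : Loc) (S T : List (Loc × Tm Loc Ch)) :
    proj a (S ++ T) = proj a S ++ proj a T := by
  induction S with
  | nil => rfl
  | cons p S ih =>
    obtain ⟨b, N⟩ := p
    simp only [List.cons_append, proj, ih]
    split_ifs <;> rfl

theorem exists_proj (l : List Loc) (hl : l.Nodup) (g : Loc → List (Tm Loc Ch)) :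
    ∃ S : List (Loc × Tm Loc Ch), ∀ a, proj a S = if a ∈ l then g a else [] := by
  induction l with
  | nil => exact ⟨[], by simp [proj]⟩
  | cons b l ih =>
    obtain ⟨S, hS⟩ := ih (List.nodup_cons.1 hl).2
    have hb := (List.nodup_cons.1 hl).1
    have key : ∀ (L : List (Tm Loc Ch)) a,
        proj a (L.map (fun N => (b, N))) = if a = b then L else [] := by
      intro L a
      induction L with
      | nil => simp [proj]
      | cons N L ih => simp only [List.map_cons, proj, ih]; split_ifs <;> rfl
    refine ⟨(g b).map (fun N => (b, N)) ++ S, fun a => ?_⟩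
    rw [proj_append, key, hS]
    by_cases h : a = b
    · subst h; simp [hb]
    · simp [h]

theorem exists_proj' (g : Loc → List (Tm Loc Ch)) (hg : {a | g a ≠ []}.Finite) :
    ∃ S : List (Loc × Tm Loc Ch), ∀ a, proj a S = g a := by
  obtain ⟨S, hS⟩ := exists_proj hg.toFinset.toList (Finset.nodup_toList _) g
  refine ⟨S, fun a => ?_⟩
  rw [hS]
  by_cases h : g a = [] <;> simp [h]

theorem proj_finite (S : List (Loc × Tm Loc Ch)) : {a | proj a S ≠ []}.Finite := by
  refine (S.map Prod.fst).toFinset.finite_toSet.subset ?_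
  intro a ha
  induction S with
  | nil => simp [proj] at ha
  | cons p S ih =>
    obtain ⟨b, N⟩ := p
    by_cases h : a = b
    · simp [h]
    · have : a ∈ {a | proj a S ≠ []} := by simpa [proj, h] using ha
      have := ih this
      simp at this ⊢
      exact .inr this

theorem RedM.frame_finite {s : MemTy Loc Ch} {F : Loc → List (Tm Loc Ch)}
    {S : List (Loc × Tm Loc Ch)} (h : RedM s F S) : {a | F a ≠ []}.Finite := by
  refine (proj_finite S).subset fun a ha => ?_
  obtain ⟨L, h1, _⟩ := h a
  simp only [Set.mem_setOf_eq, h1] at ha ⊢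
  simp [ha]

theorem exists_redM (s : MemTy Loc Ch) (F : Loc → List (Tm Loc Ch))
    (hs : {a | s a ≠ []}.Finite) (hF : {a | F a ≠ []}.Finite)
    (h : ∀ a, ∀ t ∈ s a, Red t (.var 0)) : ∃ S, RedM s F S := by
  obtain ⟨S, hS⟩ := exists_proj' (fun a => (s a).map (fun _ => Tm.var 0) ++ F a)
    ((hs.union hF).subset (by
      intro a ha
      by_contra hc
      simp at hc ha
      exact ha hc.1 hc.2))
  refine ⟨S, fun a => ⟨_, hS a, ?_⟩⟩
  have := h a
  generalize s a = l at this
  induction l with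
  | nil => simp [RedL]
  | cons t l ih =>
    simp only [List.map_cons, RedL]
    exact ⟨_, _, rfl, this t (by simp), ih (fun t ht => this t (by simp [ht]))⟩

theorem red_var {t : Ty Loc Ch} (ht : TyOK t) : ∀ x, Red t (.var x) := by
  induction ht with
  | arr s T hs1 hs2 hT0 hT1 hT2 hT3 ihs ihT =>
    intro x
    rw [red_arr]
    intro F S K hS hK
    obtain ⟨i, hi⟩ := hT0
    obtain ⟨m, hm⟩ := Option.ne_none_iff_exists'.1 hi
    obtain ⟨S', hS'⟩ := exists_redM m F (hT2 i m hm) hS.frame_finite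
      (fun a t ht => ihT i m hm a t ht 0)
    obtain ⟨h, n, hr⟩ := hK i m hm S' hS'
    exact ⟨_, _, .var S x hr⟩

theorem TyOK.exists_redM {s : MemTy Loc Ch} {T : SumTy Loc Ch} (h : TyOK (.arr s T))
    (F : Loc → List (Tm Loc Ch)) (hF : {a | F a ≠ []}.Finite) : ∃ S, RedM s F S := by
  cases h with
  | arr _ _ hs1 hs2 =>
    exact _root_.exists_redM s F hs1 hF (fun a t ht => red_var (hs2 a t ht) 0)

theorem redK_nil (T : SumTy Loc Ch) (F : Loc → List (Tm Loc Ch)) : RedK T F [] :=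
  fun i _ _ S _ => ⟨0, 0, .fin S i⟩

/-- Every reducible term of OK type has a run. -/
theorem Red.exists_run {t : Ty Loc Ch} (ht : TyOK t) {M : Tm Loc Ch} (h : Red t M) :
    ∃ k n S K, Run k n S M K := by
  obtain ⟨s, T⟩ := t
  obtain ⟨S, hS⟩ := ht.exists_redM (fun _ => []) (by simp)
  obtain ⟨k, n, hr⟩ := (red_arr s T M).1 h _ S [] hS (redK_nil _ _)
  exact ⟨k, n, S, [], hr⟩

theorem TypingOK.tyOK {Γ : List (Ty Loc Ch)} {M : Tm Loc Ch} {t : Ty Loc Ch}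
    (h : TypingOK Γ M t) : TyOK t := by
  cases h <;> assumption

theorem exists_pops (a : Loc) (S : List (Loc × Tm Loc Ch)) (N : Tm Loc Ch)
    (L : List (Tm Loc Ch)) (h : proj a S = N :: L) :
    ∃ S', Pops a S N S' ∧ proj a S' = L ∧ ∀ b, b ≠ a → proj b S' = proj b S := by
  induction S with
  | nil => simp [proj] at h
  | cons p S ih =>
    obtain ⟨c, P⟩ := p
    by_cases hc : a = c
    · subst hc
      simp only [proj, if_true, List.cons.injEq] at h
      obtain ⟨rfl, h⟩ := h
      exact ⟨S, .here _ _, h, fun b hb => by simp [proj, hb]⟩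
    · simp only [proj, hc, if_false] at h
      obtain ⟨S', h1, h2, h3⟩ := ih h
      refine ⟨(c, P) :: S', .there _ _ hc h1, by simp [proj, hc, h2], fun b hb => ?_⟩
      simp only [proj, h3 b hb]

theorem fundamental {Γ : List (Ty Loc Ch)} {M : Tm Loc Ch} {t : Ty Loc Ch}
    (h : TypingOK Γ M t) : M.loopFree → ∀ σ : ℕ → Tm Loc Ch,
    (∀ n t, Γ[n]? = some t → Red t (σ n)) → Red t (M.inst σ) := by
  induction h with
  | var Γ n t h hok => intro _ σ hσ; exact hσ n t h
  | choice Γ i hok =>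
    intro _ σ hσ
    rw [red_arr]
    intro F S K hS hK
    exact hK i memNil (by simp [sumSingle]) S hS
  | push Γ N r a M s T hok hN hM ihN ihM =>
    intro hl σ hσ
    rw [red_arr]
    intro F S K hS hK
    have hN' := ihN hl.1 σ hσ
    obtain ⟨k, m, S1, K1, hr1⟩ := hN'.exists_run hN.tyOK
    obtain ⟨h, n, hr⟩ := (red_arr _ _ _).1 (ihM hl.2 σ hσ) F ((a, N.inst σ) :: S) K (by
      intro b
      obtain ⟨L, h1, h2⟩ := hS b
      by_cases hb : b = a
      · subst hb
        refine ⟨N.inst σ :: L, by simp [proj, h1], ?_⟩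
        simp only [memCons, Function.update_self, RedL]
        exact ⟨_, _, rfl, hN', h2⟩
      · exact ⟨L, by simp [proj, hb, h1], by simpa [memCons, hb] using h2⟩) hK
    exact ⟨_, _, .push hr hr1⟩
  | pop Γ r a M s T hok hM ih =>
    intro hl σ hσ
    rw [red_arr]
    intro F S K hS hK
    obtain ⟨L, h1, h2⟩ := hS a
    simp only [memCons, Function.update_self, RedL] at h2
    obtain ⟨N, L', rfl, h3, h4⟩ := h2
    obtain ⟨S', h5, h6, h7⟩ := exists_pops a S N _ h1
    obtain ⟨h, n, hr⟩ := (red_arr _ _ _).1 (ih hl (consS N σ) (by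
      intro n t ht
      cases n with
      | zero => simp at ht; subst ht; exact h3
      | succ n => exact hσ n t (by simpa using ht))) F S' K (by
      intro b
      by_cases hb : b = a
      · subst hb; exact ⟨L', h6, h4⟩
      · obtain ⟨L, h8, h9⟩ := hS b
        exact ⟨L, by rw [h7 b hb, h8], by simpa [memCons, hb] using h9⟩) hK
    rw [← Tm.inst_up_subst] at hr
    exact ⟨_, _, .pop h5 hr⟩
  | caseOf Γ M N i r s T hok hM hN ihM ihN =>
    intro hl σ hσ
    rw [red_arr]
    intro F S K hS hK
    have hN' := (red_arr _ _ _).1 (ihN hl.2 σ hσ)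
    obtain ⟨h, n, hr⟩ := (red_arr _ _ _).1 (ihM hl.1 σ hσ) F S ((i, N.inst σ) :: K) hS (by
      intro j m hj S' hS'
      by_cases hji : j = i
      · subst hji
        simp at hj
        subst hj
        obtain ⟨h, n, hr⟩ := hN' F S' K hS' hK
        exact ⟨_, _, .sel _ hr⟩
      · obtain ⟨S1, hS1⟩ := hN.tyOK.exists_redM F hS.frame_finite
        obtain ⟨h, n, hr⟩ := hN' F S1 K hS1 hK
        obtain ⟨h', n', hr'⟩ := hK j m (by simpa [hji] using hj) S' hS'
        exact ⟨_, _, .rej _ _ hji hr' hr⟩)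
    exact ⟨_, _, .caseOf hr⟩
  | loop => intro hl; exact absurd hl (by simp [Tm.loopFree])
  | expand Γ M r s T hok hM ih =>
    intro hl σ hσ
    rw [red_arr]
    intro F S K hS hK
    have : ∀ a, ∃ L1 L2, proj a S = L1 ++ (L2 ++ F a) ∧ RedL (r a) L1 ∧ RedL (s a) L2 := by
      intro a
      obtain ⟨L, h1, h2⟩ := hS a
      obtain ⟨L1, L2, rfl, h3, h4⟩ := redL_append _ _ _ h2
      exact ⟨L1, L2, by simp [h1], h3, h4⟩
    choose L1 L2 h1 h2 h3 using this
    refine (red_arr _ _ _).1 (ih hl σ hσ) (fun a => L2 a ++ F a) S K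
      (fun a => ⟨L1 a, h1 a, h2 a⟩) ?_
    intro i m hi S' hS'
    refine hK i (memApp m s) (by simp [sumExpand, hi]) S' fun a => ?_
    obtain ⟨L, h4, h5⟩ := hS' a
    exact ⟨L ++ L2 a, by simp [h4], redL_append' _ _ _ _ h5 (h3 a)⟩
  | incl Γ M r T U h hok hM ih =>
    intro hl σ hσ
    rw [red_arr]
    intro F S K hS hK
    refine (red_arr _ _ _).1 (ih hl σ hσ) F S K hS ?_
    intro i m hi
    exact hK i m (by simp [sumOver, hi])

/-- Typed strong normalization: a loop-free term typed with a derivation in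
which every sum type is indexed by a nonempty finite set of choices admits
no infinite reduction sequence. -/
theorem typed_strong_normalization (Γ : List (Ty Loc Ch)) (M : Tm Loc Ch) (t : Ty Loc Ch)
    (hΓ : ∀ s ∈ Γ, TyOK s) (hM : M.loopFree) (hty : TypingOK Γ M t) :
    ¬ ∃ f : ℕ → Tm Loc Ch, f 0 = M ∧ ∀ n, Step (f n) (f (n + 1)) := by
  rintro ⟨f, rfl, hf⟩
  have hred : Red t ((f 0).inst Tm.var) := fundamental hty hM Tm.var
    (fun n s hs => red_var (hΓ s (List.mem_of_getElem? hs)) n)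
  rw [Tm.inst_var] at hred
  obtain ⟨k, n, S, K, hr⟩ := hred.exists_run hty.tyOK
  exact Run.no_infinite n _ k S K f rfl hr hf
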